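/- For every T ∈ R(V): the (∥u)-component of Weyl(T) equals Weyl_u(T^∥), and the fully tangential projection satisfies Weyl(T)^∥ = Weyl_u(T^∥) + (1/(n−2)) ((1/(n−3)) hat(Ric(T^∥)) − ε T̂^⊥) ∧ γ. -/

import Mathlib

open scoped BigOperators

noncomputable section

namespace Decomp

abbrev Vec (n : ℕ) := Fin n → ℝ
abbrev Ten2 (n : ℕ) := Fin n → Fin n → ℝ
abbrev Ten3 (n : ℕ) := Fin n → Fin n → Fin n → ℝ
abbrev Ten4 (n : ℕ) := Fin n → Fin n → Fin n → Fin n → ℝ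

variable {n : ℕ}

/-- A (0,4)-tensor with the algebraic symmetries of a Riemann tensor. -/
def IsRiemannType (T : Ten4 n) : Prop :=
  (∀ α β μ ν, T α β μ ν = - T α β ν μ) ∧
  (∀ α β μ ν, T α β μ ν = - T β α μ ν) ∧
  (∀ α β μ ν, T α β μ ν = T μ ν α β) ∧
  (∀ α β μ ν, T α β μ ν + T α μ ν β + T α ν β μ = 0)

/-- A (0,3)-tensor antisymmetric in the last two indices with vanishing cyclic sum. -/
def IsLambda12 (F : Ten3 n) : Prop :=
  (∀ α μ ν, F α μ ν = - F α ν μ) ∧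
  (∀ α μ ν, F α μ ν + F μ ν α + F ν α μ = 0)

def IsSym2 (S : Ten2 n) : Prop := ∀ α β, S α β = S β α

/-- Ricci-type trace of a (0,4)-tensor (first and third indices, using the inverse metric). -/
def RicT (ginv : Ten2 n) (T : Ten4 n) : Ten2 n :=
  fun β ν => ∑ α, ∑ μ, ginv α μ * T α β μ ν

/-- Scalar-type trace. -/
def ScalT (ginv : Ten2 n) (T : Ten4 n) : ℝ :=
  ∑ β, ∑ ν, ginv β ν * RicT ginv T β ν

/-- Weyl-type: Riemann-type and trace-free in the first and third indices. -/
def IsWeylType (ginv : Ten2 n) (T : Ten4 n) : Prop :=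
  IsRiemannType T ∧ ∀ β ν, RicT ginv T β ν = 0

/-- Kulkarni–Nomizu product. -/
def KN (A B : Ten2 n) : Ten4 n := fun α β μ ν =>
  A α μ * B β ν - A α ν * B β μ - A β μ * B α ν + A β ν * B α μ

/-- (u ⊛ F) for a one-form w and F ∈ Λ^{(1,2)}. -/
def circ (w : Vec n) (F : Ten3 n) : Ten4 n := fun α β μ ν =>
  w α * F β μ ν - w β * F α μ ν + w μ * F ν α β - w ν * F μ α β

/-- Lower an index with the metric. -/
def lower (g : Ten2 n) (u : Vec n) : Vec n := fun α => ∑ β, g α β * u β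

/-- Projector orthogonal to `u`, both indices covariant: γ_{αβ} = g_{αβ} − ε u_α u_β. -/
def gam (g : Ten2 n) (ε : ℝ) (u : Vec n) : Ten2 n := fun α β =>
  g α β - ε * lower g u α * lower g u β

/-- Mixed projector γ^κ_μ = δ^κ_μ − ε u^κ u_μ. -/
def gamMix (g : Ten2 n) (ε : ℝ) (u : Vec n) : Ten2 n := fun κ μ =>
  (if κ = μ then (1 : ℝ) else 0) - ε * u κ * lower g u μ

/-- Contravariant projector γ^{αβ} = g^{αβ} − ε u^α u^β. -/
def gamUp (ginv : Ten2 n) (ε : ℝ) (u : Vec n) : Ten2 n := fun α β =>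
  ginv α β - ε * u α * u β

/-- η := u⊗u − (ε/(n−3)) γ. -/
def eta (g : Ten2 n) (ε : ℝ) (u : Vec n) : Ten2 n := fun α β =>
  lower g u α * lower g u β - (ε / ((n : ℝ) - 3)) * gam g ε u α β

/-- T^⊥_{βν} := u^α u^μ T_{αβμν}. -/
def perp (u : Vec n) (T : Ten4 n) : Ten2 n := fun β ν =>
  ∑ α, ∑ μ, u α * u μ * T α β μ ν

/-- T^{⊥∥}_{βμν} := u^α γ^κ_μ γ^σ_ν T_{αβκσ}. -/
def perppar (g : Ten2 n) (ε : ℝ) (u : Vec n) (T : Ten4 n) : Ten3 n := fun β μ ν =>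
  ∑ α, ∑ κ, ∑ σ, u α * gamMix g ε u κ μ * gamMix g ε u σ ν * T α β κ σ

/-- T^∥ : projection of T with γ in all four indices. -/
def par4 (g : Ten2 n) (ε : ℝ) (u : Vec n) (T : Ten4 n) : Ten4 n := fun α β μ ν =>
  ∑ ρ, ∑ σ, ∑ κ, ∑ δ,
    gamMix g ε u ρ α * gamMix g ε u σ β * gamMix g ε u κ μ * gamMix g ε u δ ν * T ρ σ κ δ

/-- T^{∥u} := T^∥ + (ε/(n−3)) T^⊥ ∧ γ. -/
def parU (g : Ten2 n) (ε : ℝ) (u : Vec n) (T : Ten4 n) : Ten4 n := fun α β μ ν =>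
  par4 g ε u T α β μ ν + (ε / ((n : ℝ) - 3)) * KN (perp u T) (gam g ε u) α β μ ν

/-- Complete orthogonality to `u` for (0,2)-tensors. -/
def Orth2 (u : Vec n) (S : Ten2 n) : Prop :=
  (∀ β, (∑ α, u α * S α β) = 0) ∧ (∀ β, (∑ α, u α * S β α) = 0)

/-- Complete orthogonality to `u` for (0,3)-tensors. -/
def Orth3 (u : Vec n) (F : Ten3 n) : Prop :=
  (∀ μ ν, (∑ α, u α * F α μ ν) = 0) ∧ (∀ μ ν, (∑ α, u α * F μ α ν) = 0) ∧
    (∀ μ ν, (∑ α, u α * F μ ν α) = 0)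

/-- Complete orthogonality to `u` for (0,4)-tensors. -/
def Orth4 (u : Vec n) (T : Ten4 n) : Prop :=
  (∀ β μ ν, (∑ α, u α * T α β μ ν) = 0) ∧ (∀ β μ ν, (∑ α, u α * T β α μ ν) = 0) ∧
    (∀ β μ ν, (∑ α, u α * T β μ α ν) = 0) ∧ (∀ β μ ν, (∑ α, u α * T β μ ν α) = 0)

/-- tr_γ of a (0,2)-tensor. -/
def trGam (ginv : Ten2 n) (ε : ℝ) (u : Vec n) (S : Ten2 n) : ℝ :=
  ∑ α, ∑ β, gamUp ginv ε u α β * S α β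

/-- Schouten-type tensor of a (0,4)-tensor. -/
def SchT (g ginv : Ten2 n) (T : Ten4 n) : Ten2 n := fun β ν =>
  (1 / ((n : ℝ) - 2)) * (RicT ginv T β ν - ScalT ginv T / (2 * ((n : ℝ) - 1)) * g β ν)

/-- Weyl-type part of a (0,4)-tensor: Weyl(T) := T − Sch(T) ∧ g. -/
def WeylT (g ginv : Ten2 n) (T : Ten4 n) : Ten4 n := fun α β μ ν =>
  T α β μ ν - KN (SchT g ginv T) g α β μ ν

/-- Sch_u for Riemann-type tensors completely orthogonal to u. -/
def SchU (g ginv : Ten2 n) (ε : ℝ) (u : Vec n) (P : Ten4 n) : Ten2 n := fun β ν =>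
  (1 / ((n : ℝ) - 3)) * (RicT ginv P β ν - ScalT ginv P / (2 * ((n : ℝ) - 2)) * gam g ε u β ν)

/-- Weyl_u for Riemann-type tensors completely orthogonal to u. -/
def WeylU (g ginv : Ten2 n) (ε : ℝ) (u : Vec n) (P : Ten4 n) : Ten4 n := fun α β μ ν =>
  P α β μ ν - KN (SchU g ginv ε u P) (gam g ε u) α β μ ν

/-- Z_tr := tr_γ T^⊥. -/
def Ztr (ginv : Ten2 n) (ε : ℝ) (u : Vec n) (T : Ten4 n) : ℝ :=
  trGam ginv ε u (perp u T)

/-- γ-trace-free part of an orthogonal symmetric (0,2)-tensor. -/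
def hat2 (g ginv : Ten2 n) (ε : ℝ) (u : Vec n) (S : Ten2 n) : Ten2 n := fun β ν =>
  S β ν - trGam ginv ε u S / ((n : ℝ) - 1) * gam g ε u β ν

/-- T̂^⊥ := T^⊥ − (Z_tr/(n−1)) γ. -/
def hatPerp (g ginv : Ten2 n) (ε : ℝ) (u : Vec n) (T : Ten4 n) : Ten2 n :=
  hat2 g ginv ε u (perp u T)

/-- (V_tr)_μ := γ^{αβ} T^{⊥∥}_{αβμ}. -/
def Vtr (g ginv : Ten2 n) (ε : ℝ) (u : Vec n) (T : Ten4 n) : Vec n := fun μ =>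
  ∑ α, ∑ β, gamUp ginv ε u α β * perppar g ε u T α β μ

/-- T̂^{⊥∥}_{αβμ} := T^{⊥∥}_{αβμ} + (1/(n−2))(−γ_{αβ}(V_tr)_μ + γ_{αμ}(V_tr)_β). -/
def hatPerppar (g ginv : Ten2 n) (ε : ℝ) (u : Vec n) (T : Ten4 n) : Ten3 n := fun α β μ =>
  perppar g ε u T α β μ + (1 / ((n : ℝ) - 2)) *
    (- gam g ε u α β * Vtr g ginv ε u T μ + gam g ε u α μ * Vtr g ginv ε u T β)

/-- S^∥_{βν} := γ^ρ_β γ^κ_ν S_{ρκ}. -/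
def s2par (g : Ten2 n) (ε : ℝ) (u : Vec n) (S : Ten2 n) : Ten2 n := fun β ν =>
  ∑ ρ, ∑ κ, gamMix g ε u ρ β * gamMix g ε u κ ν * S ρ κ

/-- S^{⊥∥}_β := γ^ρ_β u^κ S_{ρκ}. -/
def s2perppar (g : Ten2 n) (ε : ℝ) (u : Vec n) (S : Ten2 n) : Vec n := fun β =>
  ∑ ρ, ∑ κ, gamMix g ε u ρ β * u κ * S ρ κ

/-- S^⊥ := u^ρ u^κ S_{ρκ}. -/
def s2perp (u : Vec n) (S : Ten2 n) : ℝ := ∑ ρ, ∑ κ, u ρ * u κ * S ρ κ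

/-- σ^{(2)}_{βν} := σ_{βρ} σ^ρ{}_ν. -/
def sq (ginv : Ten2 n) (σ : Ten2 n) : Ten2 n := fun β ν =>
  ∑ ρ, ∑ κ, σ β ρ * ginv ρ κ * σ κ ν

/-- Mixed projector h^μ_{μ'} = γ^μ_{μ'} + ε y^μ y_{μ'} orthogonal to span{u,y}. -/
def hMix (g : Ten2 n) (ε : ℝ) (u y : Vec n) : Ten2 n := fun μ μ' =>
  gamMix g ε u μ μ' + ε * y μ * lower g y μ'

/-- Covariant projector h_{αβ} = γ_{αβ} + ε y_α y_β. -/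
def hCov (g : Ten2 n) (ε : ℝ) (u y : Vec n) : Ten2 n := fun α β =>
  gam g ε u α β + ε * lower g y α * lower g y β

/-- g is a symmetric nondegenerate bilinear form with (symmetric) inverse ginv. -/
def GoodMetric (g ginv : Ten2 n) : Prop :=
  (∀ α β, g α β = g β α) ∧ (∀ α β, ginv α β = ginv β α) ∧
    (∀ α β, (∑ μ, ginv α μ * g μ β) = if α = β then (1 : ℝ) else 0) ∧
    (∀ α β, (∑ μ, g α μ * ginv μ β) = if α = β then (1 : ℝ) else 0)

/-- u is a unit vector with g(u,u) = ε ∈ {−1,1}. -/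
def UnitVec (g : Ten2 n) (ε : ℝ) (u : Vec n) : Prop :=
  (ε = 1 ∨ ε = -1) ∧ (∑ α, ∑ β, g α β * u α * u β) = ε


section Sums

variable {ι : Type*} [Fintype ι]

lemma sum_comm_pairs (f : ι → ι → ι → ι → ℝ) :
    ∑ a, ∑ b, ∑ c, ∑ d, f a b c d = ∑ c, ∑ d, ∑ a, ∑ b, f a b c d := by
  calc ∑ a, ∑ b, ∑ c, ∑ d, f a b c d
      = ∑ a, ∑ c, ∑ b, ∑ d, f a b c d := Finset.sum_congr rfl fun _ _ => Finset.sum_comm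
    _ = ∑ c, ∑ a, ∑ b, ∑ d, f a b c d := Finset.sum_comm
    _ = ∑ c, ∑ a, ∑ d, ∑ b, f a b c d :=
        Finset.sum_congr rfl fun _ _ => Finset.sum_congr rfl fun _ _ => Finset.sum_comm
    _ = _ := Finset.sum_congr rfl fun _ _ => Finset.sum_comm

lemma sum_mul_sum_outer (f h : ι → ι → ℝ) :
    ∑ a, ∑ b, ∑ c, ∑ d, f a c * h b d = (∑ a, ∑ c, f a c) * ∑ b, ∑ d, h b d := by
  simp_rw [Finset.sum_mul, Finset.mul_sum]
  exact Finset.sum_congr rfl fun _ _ => Finset.sum_comm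

lemma sum_mul_sum_inner (f h : ι → ι → ℝ) :
    ∑ a, ∑ b, ∑ c, ∑ d, f a d * h b c = (∑ a, ∑ d, f a d) * ∑ b, ∑ c, h b c := by
  rw [← sum_mul_sum_outer]
  exact Finset.sum_congr rfl fun _ _ => Finset.sum_congr rfl fun _ _ => Finset.sum_comm

end Sums

lemma UnitVec.sq_eps {g : Ten2 n} {ε : ℝ} {u : Vec n} (hu : UnitVec g ε u) : ε * ε = 1 := by
  rcases hu.1 with h | h <;> rw [h] <;> norm_num

lemma UnitVec.sum_mul_lower {g : Ten2 n} {ε : ℝ} {u : Vec n} (hu : UnitVec g ε u) :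
    ∑ α, u α * lower g u α = ε := by
  rw [← hu.2]
  simp_rw [lower, Finset.mul_sum]
  exact Finset.sum_congr rfl fun _ _ => Finset.sum_congr rfl fun _ _ => by ring

/-- Contracting with the mixed projector subtracts the component along `u`. -/
lemma sum_gamMix_mul (g : Ten2 n) (ε : ℝ) (u f : Vec n) (μ : Fin n) :
    ∑ κ, gamMix g ε u κ μ * f κ = f μ - ε * lower g u μ * ∑ κ, u κ * f κ := by
  simp only [gamMix, sub_mul, ite_mul, one_mul, zero_mul, Finset.sum_sub_distrib,
    Finset.sum_ite_eq', Finset.mem_univ, if_true, Finset.mul_sum]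
  congr 1
  exact Finset.sum_congr rfl fun _ _ => by ring

lemma sum_mul_gamMix {g : Ten2 n} {ε : ℝ} {u : Vec n} (hu : UnitVec g ε u) (ρ : Fin n) :
    ∑ α, u α * gamMix g ε u ρ α = 0 := by
  have h : ∀ α, u α * gamMix g ε u ρ α
      = (if ρ = α then u α else 0) - ε * u ρ * (u α * lower g u α) := by
    intro α; simp only [gamMix]; split_ifs <;> ring
  simp only [h, Finset.sum_sub_distrib, ← Finset.mul_sum, hu.sum_mul_lower, Finset.sum_ite_eq,
    Finset.mem_univ, if_true]
  linear_combination (-u ρ) * hu.sq_eps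

lemma s2par_eq (g : Ten2 n) (ε : ℝ) (u : Vec n) (S : Ten2 n) (β ν : Fin n) :
    s2par g ε u S β ν = S β ν - ε * lower g u ν * (∑ κ, u κ * S β κ)
      - ε * lower g u β * (∑ ρ, u ρ * S ρ ν)
      + ε * lower g u β * (ε * lower g u ν) * s2perp u S := by
  have h : s2par g ε u S β ν
      = ∑ ρ, gamMix g ε u ρ β * ∑ κ, gamMix g ε u κ ν * S ρ κ := by
    simp_rw [s2par, Finset.mul_sum]
    exact Finset.sum_congr rfl fun _ _ => Finset.sum_congr rfl fun _ _ => by ring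
  have h2 : s2perp u S = ∑ ρ, u ρ * ∑ κ, u κ * S ρ κ := by
    simp_rw [s2perp, Finset.mul_sum]
    exact Finset.sum_congr rfl fun _ _ => Finset.sum_congr rfl fun _ _ => by ring
  simp only [h, h2, sum_gamMix_mul, mul_sub, Finset.sum_sub_distrib]
  have h3 : ∑ κ, u κ * (ε * lower g u ν * ∑ x, u x * S κ x)
      = ε * lower g u ν * ∑ κ, u κ * ∑ x, u x * S κ x := by
    rw [Finset.mul_sum]
    exact Finset.sum_congr rfl fun _ _ => by ring
  rw [h3]
  ring

lemma s2par_lin (g : Ten2 n) (ε : ℝ) (u : Vec n) (S R : Ten2 n) (a b : ℝ) (β ν : Fin n) :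
    s2par g ε u (fun β ν => a * S β ν + b * R β ν) β ν
      = a * s2par g ε u S β ν + b * s2par g ε u R β ν := by
  simp only [s2par, Finset.mul_sum, ← Finset.sum_add_distrib]
  exact Finset.sum_congr rfl fun _ _ => Finset.sum_congr rfl fun _ _ => by ring

lemma s2perp_lin (u : Vec n) (S R : Ten2 n) (a b : ℝ) :
    s2perp u (fun β ν => a * S β ν + b * R β ν) = a * s2perp u S + b * s2perp u R := by
  simp only [s2perp, Finset.mul_sum, ← Finset.sum_add_distrib]
  exact Finset.sum_congr rfl fun _ _ => Finset.sum_congr rfl fun _ _ => by ring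

section Metric

variable {g ginv : Ten2 n} {ε : ℝ} {u : Vec n}

lemma sum_mul_metric (hg : GoodMetric g ginv) (β : Fin n) :
    ∑ α, u α * g α β = lower g u β :=
  Finset.sum_congr rfl fun α _ => by rw [hg.1 α β, mul_comm]

lemma sum_mul_metric' (β : Fin n) : ∑ α, u α * g β α = lower g u β :=
  Finset.sum_congr rfl fun _ _ => mul_comm _ _

lemma s2perp_metric (hu : UnitVec g ε u) : s2perp u g = ε := by
  rw [← hu.2]
  exact Finset.sum_congr rfl fun _ _ => Finset.sum_congr rfl fun _ _ => by ring

lemma s2par_metric (hg : GoodMetric g ginv) (hu : UnitVec g ε u) (β ν : Fin n) :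
    s2par g ε u g β ν = gam g ε u β ν := by
  rw [s2par_eq, sum_mul_metric hg, sum_mul_metric', s2perp_metric hu, gam]
  linear_combination (ε * lower g u β * lower g u ν) * hu.sq_eps

lemma sum_ginv_mul_lower (hg : GoodMetric g ginv) (κ : Fin n) :
    ∑ μ, ginv κ μ * lower g u μ = u κ := by
  simp_rw [lower, Finset.mul_sum]
  rw [Finset.sum_comm]
  simp_rw [← mul_assoc, ← Finset.sum_mul, hg.2.2.1]
  simp

lemma sum_ginv_gamMix (hg : GoodMetric g ginv) (hu : UnitVec g ε u) (ρ κ : Fin n) :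
    ∑ α, ∑ μ, ginv α μ * (gamMix g ε u ρ α * gamMix g ε u κ μ) = gamUp ginv ε u ρ κ := by
  have h : ∀ α, ∑ μ, ginv α μ * (gamMix g ε u ρ α * gamMix g ε u κ μ)
      = gamMix g ε u ρ α * ginv α κ - ε * u κ * (u α * gamMix g ε u ρ α) := by
    intro α
    have h1 : ∀ μ, ginv α μ * (gamMix g ε u ρ α * gamMix g ε u κ μ)
        = (if κ = μ then gamMix g ε u ρ α * ginv α μ else 0)
          - ε * u κ * gamMix g ε u ρ α * (ginv α μ * lower g u μ) := by
      intro μ; simp only [gamMix]; split_ifs <;> ring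
    simp only [h1, Finset.sum_sub_distrib, ← Finset.mul_sum, sum_ginv_mul_lower hg,
      Finset.sum_ite_eq, Finset.mem_univ, if_true]
    ring
  have h2 : ∀ α, gamMix g ε u ρ α * ginv α κ
      = (if ρ = α then ginv α κ else 0) - ε * u ρ * (ginv κ α * lower g u α) := by
    intro α; rw [hg.2.1 κ α]; simp only [gamMix]; split_ifs <;> ring
  simp only [h, h2, Finset.sum_sub_distrib, ← Finset.mul_sum, sum_mul_gamMix hu,
    sum_ginv_mul_lower hg, Finset.sum_ite_eq, Finset.mem_univ, if_true, gamUp]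
  ring

lemma sum_gamUp (S : Ten2 n) :
    ∑ α, ∑ β, gamUp ginv ε u α β * S α β = (∑ α, ∑ β, ginv α β * S α β) - ε * s2perp u S := by
  simp only [s2perp, Finset.mul_sum, ← Finset.sum_sub_distrib, gamUp]
  exact Finset.sum_congr rfl fun _ _ => Finset.sum_congr rfl fun _ _ => by ring

lemma sum_ginv_s2par (hg : GoodMetric g ginv) (hu : UnitVec g ε u) (S : Ten2 n) :
    ∑ α, ∑ μ, ginv α μ * s2par g ε u S α μ
      = (∑ α, ∑ β, ginv α β * S α β) - ε * s2perp u S := by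
  rw [← sum_gamUp]
  simp_rw [s2par, Finset.mul_sum]
  rw [sum_comm_pairs]
  simp_rw [← sum_ginv_gamMix hg hu, Finset.sum_mul]
  refine Finset.sum_congr rfl fun _ _ => Finset.sum_congr rfl fun _ _ =>
    Finset.sum_congr rfl fun _ _ => Finset.sum_congr rfl fun _ _ => ?_
  ring

lemma s2perp_s2par (hu : UnitVec g ε u) (S : Ten2 n) : s2perp u (s2par g ε u S) = 0 := by
  simp_rw [s2perp, s2par, Finset.mul_sum]
  rw [sum_comm_pairs]
  refine Finset.sum_eq_zero fun ρ _ => Finset.sum_eq_zero fun κ _ => ?_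
  calc ∑ α, ∑ β, u α * u β * (gamMix g ε u ρ α * gamMix g ε u κ β * S ρ κ)
      = (∑ α, u α * gamMix g ε u ρ α) * (∑ β, u β * gamMix g ε u κ β) * S ρ κ := by
        simp_rw [Finset.sum_mul_sum, Finset.sum_mul]
        exact Finset.sum_congr rfl fun _ _ => Finset.sum_congr rfl fun _ _ => by ring
    _ = 0 := by rw [sum_mul_gamMix hu]; ring

end Metric

section Riemann

variable {g ginv : Ten2 n} {ε : ℝ} {u : Vec n} {T : Ten4 n}

lemma sum_antisymm {ι : Type*} [Fintype ι] {f : ι → ι → ℝ} (hf : ∀ a b, f a b = -f b a) :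
    ∑ a, ∑ b, f a b = 0 := by
  have h : ∑ a, ∑ b, f a b = -∑ a, ∑ b, f a b := by
    conv_lhs => rw [Finset.sum_comm]
    simp_rw [← Finset.sum_neg_distrib]
    exact Finset.sum_congr rfl fun a _ => Finset.sum_congr rfl fun b _ => hf b a
  linarith

lemma sum_mul_perp_left (hT : IsRiemannType T) (ν : Fin n) : ∑ β, u β * perp u T β ν = 0 := by
  have h : ∑ β, u β * perp u T β ν = ∑ β, ∑ α, ∑ μ, u β * (u α * u μ * T α β μ ν) := by
    simp_rw [perp, Finset.mul_sum]
  rw [h]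
  refine sum_antisymm fun β α => ?_
  rw [← Finset.sum_neg_distrib]
  refine Finset.sum_congr rfl fun μ _ => ?_
  rw [hT.2.1 α β μ ν]; ring

lemma sum_mul_perp_right (hT : IsRiemannType T) (β : Fin n) : ∑ ν, u ν * perp u T β ν = 0 := by
  have h : ∑ ν, u ν * perp u T β ν = ∑ ν, ∑ μ, ∑ α, u ν * (u α * u μ * T α β μ ν) := by
    simp_rw [perp, Finset.mul_sum]
    exact Finset.sum_congr rfl fun _ _ => Finset.sum_comm
  rw [h]
  refine sum_antisymm fun ν μ => ?_
  rw [← Finset.sum_neg_distrib]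
  refine Finset.sum_congr rfl fun α _ => ?_
  rw [hT.1 α β μ ν]; ring

lemma s2perp_perp (hT : IsRiemannType T) : s2perp u (perp u T) = 0 := by
  have h : s2perp u (perp u T) = ∑ ρ, u ρ * ∑ κ, u κ * perp u T ρ κ := by
    simp_rw [s2perp, Finset.mul_sum]
    exact Finset.sum_congr rfl fun _ _ => Finset.sum_congr rfl fun _ _ => by ring
  simp [h, sum_mul_perp_right hT]

lemma s2par_perp (hT : IsRiemannType T) (β ν : Fin n) :
    s2par g ε u (perp u T) β ν = perp u T β ν := by
  rw [s2par_eq, sum_mul_perp_left hT, sum_mul_perp_right hT, s2perp_perp hT]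
  ring

lemma s2perp_RicT (hT : IsRiemannType T) :
    s2perp u (RicT ginv T) = ∑ β, ∑ ν, ginv β ν * perp u T β ν := by
  simp_rw [s2perp, RicT, perp, Finset.mul_sum]
  rw [sum_comm_pairs]
  refine Finset.sum_congr rfl fun α _ => Finset.sum_congr rfl fun μ _ =>
    Finset.sum_congr rfl fun β _ => Finset.sum_congr rfl fun ν _ => ?_
  rw [hT.2.1 α β μ ν, hT.1 β α μ ν]; ring

lemma trGam_perp (hT : IsRiemannType T) :
    trGam ginv ε u (perp u T) = s2perp u (RicT ginv T) := by
  rw [trGam, sum_gamUp, s2perp_perp hT, s2perp_RicT hT]; ring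

lemma RicT_par4 (hg : GoodMetric g ginv) (hu : UnitVec g ε u) (hT : IsRiemannType T)
    (β ν : Fin n) :
    RicT ginv (par4 g ε u T) β ν = s2par g ε u (RicT ginv T) β ν - ε * perp u T β ν := by
  have h : RicT ginv (par4 g ε u T) β ν = ∑ σ, ∑ δ, gamMix g ε u σ β * gamMix g ε u δ ν *
      ∑ ρ, ∑ κ, gamUp ginv ε u ρ κ * T ρ σ κ δ := by
    calc RicT ginv (par4 g ε u T) β ν
        = ∑ α, ∑ μ, ∑ ρ, ∑ κ, ∑ σ, ∑ δ, ginv α μ * (gamMix g ε u ρ α * gamMix g ε u κ μ) *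
            (gamMix g ε u σ β * gamMix g ε u δ ν * T ρ σ κ δ) := by
          simp_rw [RicT, par4, Finset.mul_sum]
          refine Finset.sum_congr rfl fun _ _ => Finset.sum_congr rfl fun _ _ =>
            Finset.sum_congr rfl fun _ _ => ?_
          rw [Finset.sum_comm]
          exact Finset.sum_congr rfl fun _ _ => Finset.sum_congr rfl fun _ _ =>
            Finset.sum_congr rfl fun _ _ => by ring
      _ = ∑ ρ, ∑ κ, ∑ σ, ∑ δ, gamUp ginv ε u ρ κ *
            (gamMix g ε u σ β * gamMix g ε u δ ν * T ρ σ κ δ) := by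
          rw [sum_comm_pairs]
          refine Finset.sum_congr rfl fun _ _ => Finset.sum_congr rfl fun _ _ => ?_
          rw [sum_comm_pairs]
          refine Finset.sum_congr rfl fun _ _ => Finset.sum_congr rfl fun _ _ => ?_
          simp_rw [← sum_ginv_gamMix hg hu, Finset.sum_mul]
      _ = _ := by
          rw [sum_comm_pairs]
          simp_rw [Finset.mul_sum]
          exact Finset.sum_congr rfl fun _ _ => Finset.sum_congr rfl fun _ _ =>
            Finset.sum_congr rfl fun _ _ => Finset.sum_congr rfl fun _ _ => by ring
  have h2 : ∀ σ δ, ∑ ρ, ∑ κ, gamUp ginv ε u ρ κ * T ρ σ κ δ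
      = 1 * RicT ginv T σ δ + (-ε) * perp u T σ δ := by
    intro σ δ
    rw [sum_gamUp (S := fun ρ κ => T ρ σ κ δ), RicT, perp, s2perp]
    ring
  rw [h]
  simp_rw [h2]
  have h3 := s2par_lin g ε u (RicT ginv T) (perp u T) 1 (-ε) β ν
  rw [s2par_perp hT, s2par] at h3
  rw [h3]; ring

lemma ScalT_par4 (hg : GoodMetric g ginv) (hu : UnitVec g ε u) (hT : IsRiemannType T) :
    ScalT ginv (par4 g ε u T) = ScalT ginv T - 2 * ε * s2perp u (RicT ginv T) := by
  have h : ScalT ginv (par4 g ε u T) = (∑ α, ∑ β, ginv α β * s2par g ε u (RicT ginv T) α β)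
      - ε * ∑ α, ∑ β, ginv α β * perp u T α β := by
    simp only [ScalT, RicT_par4 hg hu hT, Finset.mul_sum, ← Finset.sum_sub_distrib]
    exact Finset.sum_congr rfl fun _ _ => Finset.sum_congr rfl fun _ _ => by ring
  rw [h, sum_ginv_s2par hg hu, ← s2perp_RicT hT, ScalT]
  ring

lemma trGam_RicT_par4 (hg : GoodMetric g ginv) (hu : UnitVec g ε u) (hT : IsRiemannType T) :
    trGam ginv ε u (RicT ginv (par4 g ε u T)) = ScalT ginv (par4 g ε u T) := by
  have h : RicT ginv (par4 g ε u T)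
      = fun β ν => 1 * s2par g ε u (RicT ginv T) β ν + (-ε) * perp u T β ν := by
    ext β ν; rw [RicT_par4 hg hu hT]; ring
  have h2 : s2perp u (RicT ginv (par4 g ε u T)) = 0 := by
    rw [h, s2perp_lin, s2perp_s2par hu, s2perp_perp hT]; ring
  rw [trGam, sum_gamUp, h2, ScalT]; ring

end Riemann

section KulkarniNomizu

lemma par4_KN (g : Ten2 n) (ε : ℝ) (u : Vec n) (A B : Ten2 n) (α β μ ν : Fin n) :
    par4 g ε u (KN A B) α β μ ν = KN (s2par g ε u A) (s2par g ε u B) α β μ ν := by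
  let p (S : Ten2 n) (β ν ρ κ : Fin n) := gamMix g ε u ρ β * gamMix g ε u κ ν * S ρ κ
  have h : KN (s2par g ε u A) (s2par g ε u B) α β μ ν
      = (∑ ρ, ∑ κ, p A α μ ρ κ) * (∑ ρ, ∑ κ, p B β ν ρ κ)
        - (∑ ρ, ∑ κ, p A α ν ρ κ) * (∑ ρ, ∑ κ, p B β μ ρ κ)
        - (∑ ρ, ∑ κ, p B α ν ρ κ) * (∑ ρ, ∑ κ, p A β μ ρ κ)
        + (∑ ρ, ∑ κ, p B α μ ρ κ) * (∑ ρ, ∑ κ, p A β ν ρ κ) := by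
    simp only [KN, s2par, p]; ring
  rw [h, ← sum_mul_sum_outer (p A α μ), ← sum_mul_sum_inner (p A α ν),
    ← sum_mul_sum_inner (p B α ν), ← sum_mul_sum_outer (p B α μ)]
  simp only [par4, KN, p, ← Finset.sum_add_distrib, ← Finset.sum_sub_distrib]
  exact Finset.sum_congr rfl fun _ _ => Finset.sum_congr rfl fun _ _ =>
    Finset.sum_congr rfl fun _ _ => Finset.sum_congr rfl fun _ _ => by ring

lemma par4_sub (g : Ten2 n) (ε : ℝ) (u : Vec n) (T R : Ten4 n) (α β μ ν : Fin n) :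
    par4 g ε u (fun α β μ ν => T α β μ ν - R α β μ ν) α β μ ν
      = par4 g ε u T α β μ ν - par4 g ε u R α β μ ν := by
  simp only [par4, mul_sub, Finset.sum_sub_distrib]

lemma perp_sub (u : Vec n) (T R : Ten4 n) (β ν : Fin n) :
    perp u (fun α β μ ν => T α β μ ν - R α β μ ν) β ν = perp u T β ν - perp u R β ν := by
  simp only [perp, mul_sub, Finset.sum_sub_distrib]

lemma perp_KN_metric {g ginv : Ten2 n} {ε : ℝ} {u : Vec n} (hg : GoodMetric g ginv)
    (hu : UnitVec g ε u) (S : Ten2 n) (β ν : Fin n) :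
    perp u (KN S g) β ν = ε * s2par g ε u S β ν + s2perp u S * gam g ε u β ν := by
  have h : perp u (KN S g) β ν = s2perp u S * g β ν
      - (∑ α, u α * S α ν) * (∑ μ, u μ * g β μ)
      - (∑ α, u α * g α ν) * (∑ μ, u μ * S β μ) + s2perp u g * S β ν := by
    rw [Finset.sum_mul_sum, Finset.sum_mul_sum]
    simp only [perp, KN, s2perp, Finset.sum_mul, ← Finset.sum_add_distrib,
      ← Finset.sum_sub_distrib]
    exact Finset.sum_congr rfl fun _ _ => Finset.sum_congr rfl fun _ _ => by ring
  rw [h, sum_mul_metric hg, sum_mul_metric', s2perp_metric hu, s2par_eq, gam]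
  linear_combination (lower g u ν * (∑ κ, u κ * S β κ) + lower g u β * (∑ ρ, u ρ * S ρ ν)
      - ε * lower g u β * lower g u ν * s2perp u S) * hu.sq_eps

end KulkarniNomizu

section Weyl

variable {g ginv : Ten2 n} {ε : ℝ} {u : Vec n} {T : Ten4 n}

lemma SchT_eq (g ginv : Ten2 n) (T : Ten4 n) : SchT g ginv T = fun β ν =>
    1 / ((n : ℝ) - 2) * RicT ginv T β ν
      + -(1 / ((n : ℝ) - 2) * (ScalT ginv T / (2 * ((n : ℝ) - 1)))) * g β ν := by
  ext β ν; rw [SchT]; ring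

lemma s2par_SchT (hg : GoodMetric g ginv) (hu : UnitVec g ε u) (hT : IsRiemannType T)
    (β ν : Fin n) :
    s2par g ε u (SchT g ginv T) β ν = 1 / ((n : ℝ) - 2) *
      (RicT ginv (par4 g ε u T) β ν + ε * perp u T β ν
        - ScalT ginv T / (2 * ((n : ℝ) - 1)) * gam g ε u β ν) := by
  rw [SchT_eq, s2par_lin, s2par_metric hg hu, RicT_par4 hg hu hT]; ring

lemma s2perp_SchT (hu : UnitVec g ε u) :
    s2perp u (SchT g ginv T) = 1 / ((n : ℝ) - 2) *
      (s2perp u (RicT ginv T) - ScalT ginv T / (2 * ((n : ℝ) - 1)) * ε) := by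
  rw [SchT_eq, s2perp_lin, s2perp_metric hu]; ring

lemma par4_WeylT (hg : GoodMetric g ginv) (hu : UnitVec g ε u) (α β μ ν : Fin n) :
    par4 g ε u (WeylT g ginv T) α β μ ν = par4 g ε u T α β μ ν
      - KN (s2par g ε u (SchT g ginv T)) (gam g ε u) α β μ ν := by
  have h : s2par g ε u g = gam g ε u := by ext; exact s2par_metric hg hu _ _
  rw [← h, ← par4_KN, ← par4_sub]
  rfl

lemma perp_WeylT (hg : GoodMetric g ginv) (hu : UnitVec g ε u) (β ν : Fin n) :
    perp u (WeylT g ginv T) β ν = perp u T β ν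
      - (ε * s2par g ε u (SchT g ginv T) β ν + s2perp u (SchT g ginv T) * gam g ε u β ν) := by
  rw [← perp_KN_metric hg hu, ← perp_sub]
  rfl

/-- The (0,2)-tensor identity whose Kulkarni–Nomizu product with `gam` relates `parU` to `WeylU`. -/
lemma s2par_SchT_add_perp (hn : 4 ≤ n) (hg : GoodMetric g ginv) (hu : UnitVec g ε u)
    (hT : IsRiemannType T) (β ν : Fin n) :
    -s2par g ε u (SchT g ginv T) β ν + ε / ((n : ℝ) - 3) * perp u (WeylT g ginv T) β ν
      = -SchU g ginv ε u (par4 g ε u T) β ν := by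
  have hn' : (4 : ℝ) ≤ n := by exact_mod_cast hn
  have h1 : (n : ℝ) - 1 ≠ 0 := by linarith
  have h2 : (n : ℝ) - 2 ≠ 0 := by linarith
  have h3 : (n : ℝ) - 3 ≠ 0 := by linarith
  rw [perp_WeylT hg hu, s2par_SchT hg hu hT, s2perp_SchT hu, SchU, ScalT_par4 hg hu hT]
  rcases hu.1 with h | h <;> rw [h] <;> field_simp <;> ring

lemma s2par_SchT_eq_hat (hn : 4 ≤ n) (hg : GoodMetric g ginv) (hu : UnitVec g ε u)
    (hT : IsRiemannType T) (β ν : Fin n) :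
    -s2par g ε u (SchT g ginv T) β ν = -SchU g ginv ε u (par4 g ε u T) β ν
      + 1 / ((n : ℝ) - 2) *
        (1 / ((n : ℝ) - 3) * hat2 g ginv ε u (RicT ginv (par4 g ε u T)) β ν
          - ε * hatPerp g ginv ε u T β ν) := by
  have hn' : (4 : ℝ) ≤ n := by exact_mod_cast hn
  have h1 : (n : ℝ) - 1 ≠ 0 := by linarith
  have h2 : (n : ℝ) - 2 ≠ 0 := by linarith
  have h3 : (n : ℝ) - 3 ≠ 0 := by linarith
  rw [s2par_SchT hg hu hT, hatPerp, hat2, hat2, trGam_perp hT, trGam_RicT_par4 hg hu hT, SchU,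
    ScalT_par4 hg hu hT]
  field_simp
  ring

end Weyl

/-- identities `weylproject` and (r6): the `∥u` component of `Weyl(T)`
equals `Weyl_u(T^∥)`, and the fully tangential projection of `Weyl(T)`. -/
theorem stmt10 {n : ℕ} (hn : 4 ≤ n) (g ginv : Ten2 n) (hg : GoodMetric g ginv)
    (ε : ℝ) (u : Vec n) (hu : UnitVec g ε u)
    (T : Ten4 n) (hT : IsRiemannType T) :
    (∀ α β μ ν, parU g ε u (WeylT g ginv T) α β μ ν =
        WeylU g ginv ε u (par4 g ε u T) α β μ ν) ∧
    (∀ α β μ ν, par4 g ε u (WeylT g ginv T) α β μ ν =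
        WeylU g ginv ε u (par4 g ε u T) α β μ ν
        + KN (fun β' ν' => (1 / ((n : ℝ) - 2)) *
              ((1 / ((n : ℝ) - 3)) * hat2 g ginv ε u (RicT ginv (par4 g ε u T)) β' ν'
                - ε * hatPerp g ginv ε u T β' ν'))
            (gam g ε u) α β μ ν) := by
  refine ⟨fun α β μ ν => ?_, fun α β μ ν => ?_⟩
  · have h := s2par_SchT_add_perp hn hg hu hT
    rw [parU, par4_WeylT hg hu, WeylU]
    simp only [KN]
    linear_combination gam g ε u β ν * h α μ - gam g ε u β μ * h α ν
      - gam g ε u α ν * h β μ + gam g ε u α μ * h β ν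
  · have h := s2par_SchT_eq_hat hn hg hu hT
    rw [par4_WeylT hg hu, WeylU]
    simp only [KN]
    linear_combination gam g ε u β ν * h α μ - gam g ε u β μ * h α ν
      - gam g ε u α ν * h β μ + gam g ε u α μ * h β ν

end Decomp
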